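/- Let K be a field and ω a polynomial r-form on K^n with 1 ≤ r < n. Then ω has a rational first integral if and only if ω has infinitely many pairwise non-associate invariant irreducible polynomials. -/

import Mathlib

/- Framework: rational function field `K(z) = K(z₁,…,zₙ)`, its subfield `K(zᵖ)` of
∂-constants, and rational differential forms modelled as the exterior algebra over `K(z)`
on the free module with basis `dz₁,…,dzₙ` (canonically isomorphic to the exterior powers
of the Kähler differentials `Ω¹_{K(z)/K}`); the wedge product is the algebra product. -/

set_option synthInstance.maxHeartbeats 1000000
set_option maxHeartbeats 4000000

noncomputable section
open MvPolynomial

/-- The field of rational functions `K(z₁,…,zₙ)`. -/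
abbrev Kz (K : Type) [Field K] (n : ℕ) := FractionRing (MvPolynomial (Fin n) K)

variable (K : Type) [Field K] (n : ℕ)

/-- The inclusion of polynomials into rational functions. -/
def toKz : MvPolynomial (Fin n) K →+* Kz K n := algebraMap _ _

/-- Rational differential forms on `Kⁿ`. -/
abbrev Forms (K : Type) [Field K] (n : ℕ) := ExteriorAlgebra (Kz K n) (Fin n → Kz K n)

/-- The 1-form `dz i`. -/
def dz (i : Fin n) : Forms K n := ExteriorAlgebra.ι (Kz K n) (Pi.single i 1)

/-- The 1-form with coordinates `v` with respect to the basis `dz₁,…,dzₙ`. -/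
def oneForm (v : Fin n → Kz K n) : Forms K n := ExteriorAlgebra.ι (Kz K n) v

/-- The `r`-form `dz_{s 0} ∧ ⋯ ∧ dz_{s (r-1)}`. -/
def dzP (r : ℕ) (s : Fin r → Fin n) : Forms K n := (List.ofFn fun i => dz K n (s i)).prod

/-- The partial derivative `∂/∂zᵢ`, extended from `K[z]` to `K(z)` by the quotient rule
(applied to a chosen fraction representation; the value does not depend on the choice). -/
def pd (i : Fin n) (f : Kz K n) : Kz K n :=
  let a := (IsLocalization.sec (nonZeroDivisors (MvPolynomial (Fin n) K)) f).1
  let b := ((IsLocalization.sec (nonZeroDivisors (MvPolynomial (Fin n) K)) f).2 :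
      MvPolynomial (Fin n) K)
  (toKz K n (pderiv i a) * toKz K n b - toKz K n a * toKz K n (pderiv i b)) / (toKz K n b) ^ 2

/-- The differential `df = ∑ᵢ (∂f/∂zᵢ) dzᵢ` of a rational function `f`. -/
def dd (f : Kz K n) : Forms K n := ∑ i, pd K n i f • dz K n i

/-- The `r`-form with (rational) coefficients `c`. -/
def formOf (r : ℕ) (c : (Fin r → Fin n) → Kz K n) : Forms K n := ∑ s, c s • dzP K n r s

/-- The exterior derivative of the `r`-form with coefficients `c`:
`d(∑ c_s dz_s) = ∑ (d c_s) ∧ dz_s`. -/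
def Dform (r : ℕ) (c : (Fin r → Fin n) → Kz K n) : Forms K n := ∑ s, dd K n (c s) * dzP K n r s

/-- The polynomial `r`-form with polynomial coefficients `c`. -/
def polyFormOf (r : ℕ) (c : (Fin r → Fin n) → MvPolynomial (Fin n) K) : Forms K n :=
  formOf K n r fun s => toKz K n (c s)

/-- The exterior derivative of the polynomial `r`-form with coefficients `c`. -/
def Dpoly (r : ℕ) (c : (Fin r → Fin n) → MvPolynomial (Fin n) K) : Forms K n :=
  Dform K n r fun s => toKz K n (c s)

/-- The exterior derivative of the 1-form with coordinates `v`. -/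
def d1 (v : Fin n → Kz K n) : Forms K n := ∑ j, dd K n (v j) * dz K n j

/-- The subfield `K(zᵖ) = K(z₁ᵖ,…,zₙᵖ) ⊆ K(z)` of ∂-constants. -/
def pConsts (p : ℕ) : Subfield (Kz K n) :=
  Subfield.closure (Set.range (algebraMap K (Kz K n)) ∪
    Set.range fun i : Fin n => (toKz K n (X i)) ^ p)

/-- `F` is invariant by the `r`-form `ω`: `dF ≠ 0` and `F` divides `ω ∧ dF`,
the quotient being a polynomial `(r+1)`-form (the cofactor `Θ_F`). -/
def FormInvariant (r : ℕ) (ω : Forms K n) (F : MvPolynomial (Fin n) K) : Prop :=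
  dd K n (toKz K n F) ≠ 0 ∧
    ∃ Θ : (Fin (r + 1) → Fin n) → MvPolynomial (Fin n) K,
      ω * dd K n (toKz K n F) = toKz K n F • polyFormOf K n (r + 1) Θ

/-- `f` is a rational first integral of the form `ω`: `df ≠ 0` and `ω ∧ df = 0`. -/
def IsFirstIntegral (ω : Forms K n) (f : Kz K n) : Prop :=
  dd K n f ≠ 0 ∧ ω * dd K n f = 0

/-- The `K(zᵖ)`-subspace `Ω^r_{L_d/K(zᵖ)}` spanned by the forms
`z^I · dz_{s 0} ∧ ⋯ ∧ dz_{s (r-1)}` with `0 ≤ I j ≤ p−1` and `∑ I ≤ d`. -/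
def Lforms (p d r : ℕ) : Submodule (pConsts K n p) (Forms K n) :=
  Submodule.span (pConsts K n p)
    { x | ∃ (I : Fin n → ℕ) (s : Fin r → Fin n), (∀ j, I j ≤ p - 1) ∧ (∑ j, I j ≤ d) ∧
        x = toKz K n (∏ j, X j ^ I j) • dzP K n r s }

/-- `N_K(n,d,r) = dim_{K(zᵖ)} Ω^r_{L_d/K(zᵖ)}`. -/
def NK (p d r : ℕ) : ℕ := Module.finrank (pConsts K n p) (Lforms K n p d r)

/-- The submodule of `r`-forms (the `r`-th exterior power of the module of 1-forms). -/
def gradeR (r : ℕ) : Submodule (Kz K n) (Forms K n) :=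
  (LinearMap.range (ExteriorAlgebra.ι (Kz K n) :
      (Fin n → Kz K n) →ₗ[Kz K n] Forms K n)) ^ r


section Partials

variable {K n}

lemma toKz_injective : Function.Injective (toKz K n) :=
  IsFractionRing.injective (MvPolynomial (Fin n) K) (Kz K n)

lemma toKz_eq_zero_iff {a : MvPolynomial (Fin n) K} : toKz K n a = 0 ↔ a = 0 :=
  map_eq_zero_iff _ toKz_injective

lemma toKz_ne_zero {a : MvPolynomial (Fin n) K} (h : a ≠ 0) : toKz K n a ≠ 0 :=
  fun h' => h (toKz_eq_zero_iff.1 h')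

lemma exists_mul_toKz_eq (f : Kz K n) :
    ∃ a b : MvPolynomial (Fin n) K, b ≠ 0 ∧ f * toKz K n b = toKz K n a := by
  refine ⟨(IsLocalization.sec (nonZeroDivisors (MvPolynomial (Fin n) K)) f).1,
    (IsLocalization.sec (nonZeroDivisors (MvPolynomial (Fin n) K)) f).2,
    nonZeroDivisors.ne_zero (Subtype.prop _), IsLocalization.sec_spec _ f⟩

lemma pd_mul_sq (i : Fin n) {f : Kz K n} {a b : MvPolynomial (Fin n) K} (hb : b ≠ 0)
    (h : f * toKz K n b = toKz K n a) :
    pd K n i f * toKz K n b ^ 2 =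
      toKz K n (pderiv i a) * toKz K n b - toKz K n a * toKz K n (pderiv i b) := by
  have hs := IsLocalization.sec_spec (nonZeroDivisors (MvPolynomial (Fin n) K)) f
  have hb0 := nonZeroDivisors.ne_zero
    (IsLocalization.sec (nonZeroDivisors (MvPolynomial (Fin n) K)) f).2.2
  unfold pd
  generalize (IsLocalization.sec (nonZeroDivisors (MvPolynomial (Fin n) K)) f).1 = a' at *
  generalize ((IsLocalization.sec (nonZeroDivisors (MvPolynomial (Fin n) K)) f).2 :
      MvPolynomial (Fin n) K) = b' at *
  change f * toKz K n b' = toKz K n a' at hs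
  have hB := toKz_ne_zero hb
  have hB' := toKz_ne_zero hb0
  have h1 : a' * b = a * b' := by
    apply toKz_injective
    rw [map_mul, map_mul, ← h, ← hs]
    ring
  have h2 := congrArg (fun x => toKz K n (pderiv i x)) h1
  simp only [pderiv_mul, map_add, map_mul] at h2
  have h3 := congrArg (toKz K n) h1
  simp only [map_mul] at h3
  simp only
  rw [div_mul_eq_mul_div, div_eq_iff (pow_ne_zero 2 hB')]
  linear_combination (toKz K n b * toKz K n b') * h2 -
    (toKz K n b * toKz K n (pderiv i b') + toKz K n b' * toKz K n (pderiv i b)) * h3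

lemma pd_toKz (i : Fin n) (a : MvPolynomial (Fin n) K) :
    pd K n i (toKz K n a) = toKz K n (pderiv i a) := by
  have := pd_mul_sq (K := K) (n := n) i one_ne_zero (f := toKz K n a) (a := a) (by simp)
  simpa using this

lemma pd_add (i : Fin n) (f g : Kz K n) : pd K n i (f + g) = pd K n i f + pd K n i g := by
  obtain ⟨a, b, hb, h⟩ := exists_mul_toKz_eq f
  obtain ⟨a', b', hb', h'⟩ := exists_mul_toKz_eq g
  have H := pd_mul_sq i (mul_ne_zero hb hb') (f := f + g) (a := a * b' + a' * b)
    (by simp only [map_add, map_mul, ← h, ← h']; ring)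
  have h1 := pd_mul_sq i hb h
  have h2 := pd_mul_sq i hb' h'
  simp only [pderiv_mul, map_add, map_mul, ← h, ← h'] at H h1 h2
  have hB := toKz_ne_zero hb
  have hB' := toKz_ne_zero hb'
  apply mul_right_cancel₀ (pow_ne_zero 2 (mul_ne_zero hB hB'))
  linear_combination H - toKz K n b' ^ 2 * h1 - toKz K n b ^ 2 * h2

lemma pd_mul (i : Fin n) (f g : Kz K n) :
    pd K n i (f * g) = f * pd K n i g + g * pd K n i f := by
  obtain ⟨a, b, hb, h⟩ := exists_mul_toKz_eq f
  obtain ⟨a', b', hb', h'⟩ := exists_mul_toKz_eq g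
  have H := pd_mul_sq i (mul_ne_zero hb hb') (f := f * g) (a := a * a')
    (by simp only [map_mul, ← h, ← h']; ring)
  have h1 := pd_mul_sq i hb h
  have h2 := pd_mul_sq i hb' h'
  simp only [pderiv_mul, map_add, map_mul, ← h, ← h'] at H h1 h2
  have hB := toKz_ne_zero hb
  have hB' := toKz_ne_zero hb'
  apply mul_right_cancel₀ (pow_ne_zero 2 (mul_ne_zero hB hB'))
  linear_combination H - g * toKz K n b' ^ 2 * h1 - f * toKz K n b ^ 2 * h2

/-- The partial derivative `∂/∂zᵢ` as a `K`-derivation of `K(z)`. -/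
def pdDer (i : Fin n) : Derivation K (Kz K n) (Kz K n) :=
  Derivation.mk'
    { toFun := pd K n i
      map_add' := pd_add i
      map_smul' := fun k f => by
        have hk : k • f = toKz K n (C k) * f := by
          rw [Algebra.smul_def, IsScalarTower.algebraMap_apply K (MvPolynomial (Fin n) K)]
          rfl
        have hk' : k • pd K n i f = toKz K n (C k) * pd K n i f := by
          rw [Algebra.smul_def, IsScalarTower.algebraMap_apply K (MvPolynomial (Fin n) K)]
          rfl
        rw [hk, pd_mul, pd_toKz, pderiv_C, map_zero, mul_zero, add_zero, RingHom.id_apply, hk'] }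
    (fun f g => by simpa using pd_mul i f g)

lemma pdDer_apply (i : Fin n) (f : Kz K n) : pdDer i f = pd K n i f := rfl

lemma pdDer_toKz (i : Fin n) (a : MvPolynomial (Fin n) K) :
    pdDer i (toKz K n a) = toKz K n (pderiv i a) := pd_toKz i a

lemma pderiv_comm (i j : Fin n) (F : MvPolynomial (Fin n) K) :
    pderiv i (pderiv j F) = pderiv j (pderiv i F) := by
  let D : Fin n → Derivation K (MvPolynomial (Fin n) K) (MvPolynomial (Fin n) K) := pderiv
  have h : ⁅D i, D j⁆ = 0 := by
    apply MvPolynomial.derivation_ext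
    intro k
    rw [Derivation.commutator_apply]
    classical
    simp only [D, pderiv_X, Pi.single_apply]
    split_ifs <;> simp
  have := congrArg (fun D => D F) h
  simpa [D, Derivation.commutator_apply, sub_eq_zero] using this

lemma degreeOf_pderiv_lt {i : Fin n} {F : MvPolynomial (Fin n) K} (h : pderiv i F ≠ 0) :
    degreeOf i (pderiv i F) < degreeOf i F := by
  have hpos : ∀ m ∈ (pderiv i F).support, m i < degreeOf i F := by
    intro m hm
    rw [mem_support_iff, coeff_pderiv] at hm
    have h1 : m + Finsupp.single i 1 ∈ F.support := by
      rw [mem_support_iff]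
      exact left_ne_zero_of_mul hm
    have := monomial_le_degreeOf i h1
    simp at this
    omega
  obtain ⟨m, hm⟩ := support_nonempty.2 h
  rw [degreeOf_lt_iff (lt_of_le_of_lt (Nat.zero_le _) (hpos m hm))]
  exact hpos

lemma pderiv_eq_zero_of_dvd {i : Fin n} {F : MvPolynomial (Fin n) K} (h : F ∣ pderiv i F) :
    pderiv i F = 0 := by
  by_contra h0
  obtain ⟨G, hG⟩ := h
  have hF : F ≠ 0 := fun hF => h0 (by rw [hF, map_zero])
  have hG0 : G ≠ 0 := fun hG0 => h0 (by rw [hG, hG0, mul_zero])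
  have h1 := degreeOf_pderiv_lt h0
  rw [hG, degreeOf_mul_eq hF hG0] at h1
  omega

lemma totalDegree_pderiv_le (i : Fin n) (F : MvPolynomial (Fin n) K) :
    (pderiv i F).totalDegree ≤ F.totalDegree := by
  refine Finset.sup_le fun m hm => ?_
  rw [mem_support_iff, coeff_pderiv] at hm
  refine le_trans ?_ (le_totalDegree (mem_support_iff.2 (left_ne_zero_of_mul hm)))
  rw [Finsupp.sum_add_index' (by simp) (by simp)]
  exact Nat.le_add_right _ _

end Partials

section VectorFields

variable {K n}

/-- The polynomial vector field `∑ₐ Aₐ ∂/∂zₐ`, acting on polynomials. -/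
def polyField (A : Fin n → MvPolynomial (Fin n) K) :
    Derivation K (MvPolynomial (Fin n) K) (MvPolynomial (Fin n) K) :=
  ∑ a, A a • pderiv a

/-- The polynomial vector field `∑ₐ Aₐ ∂/∂zₐ`, acting on rational functions. -/
def ratField (A : Fin n → MvPolynomial (Fin n) K) : Derivation K (Kz K n) (Kz K n) :=
  ∑ a, toKz K n (A a) • pdDer a

lemma polyField_apply (A : Fin n → MvPolynomial (Fin n) K) (F : MvPolynomial (Fin n) K) :
    polyField A F = ∑ a, A a * pderiv a F := by
  simp only [polyField, ← Derivation.coeFnAddMonoidHom_apply, map_sum, Finset.sum_apply]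
  rfl

lemma ratField_apply (A : Fin n → MvPolynomial (Fin n) K) (f : Kz K n) :
    ratField A f = ∑ a, toKz K n (A a) * pdDer a f := by
  simp only [ratField, ← Derivation.coeFnAddMonoidHom_apply, map_sum, Finset.sum_apply]
  rfl

lemma ratField_toKz (A : Fin n → MvPolynomial (Fin n) K) (F : MvPolynomial (Fin n) K) :
    ratField A (toKz K n F) = toKz K n (polyField A F) := by
  simp [ratField_apply, polyField_apply, pdDer_toKz]

lemma natCast_ne_zero_of_pderiv_pow_ne_zero {i : Fin n} {F : MvPolynomial (Fin n) K} {m : ℕ}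
    (h : pderiv i (F ^ m) ≠ 0) : (m : MvPolynomial (Fin n) K) ≠ 0 ∧ pderiv i F ≠ 0 := by
  rw [pderiv_pow] at h
  exact ⟨fun h0 => h (by simp [h0]), fun h0 => h (by simp [h0])⟩

lemma isUnit_natCast {m : ℕ} (h : (m : MvPolynomial (Fin n) K) ≠ 0) :
    IsUnit (m : MvPolynomial (Fin n) K) := by
  have h1 : (m : MvPolynomial (Fin n) K) = C (m : K) := by simp
  rw [h1] at h ⊢
  exact (IsUnit.mk0 (m : K) fun h0 => h (by rw [h0, C_0])).map C

lemma dvd_derivation_of_dvd_mul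
    (D : Derivation K (MvPolynomial (Fin n) K) (MvPolynomial (Fin n) K))
    {F M Q : MvPolynomial (Fin n) K} {m : ℕ} (hF : Prime F) (hM : ¬ F ∣ M) (hQ : ¬ F ∣ Q)
    (hm : (m : MvPolynomial (Fin n) K) ≠ 0) (h : F ^ m * M ∣ Q * D (F ^ m * M)) :
    F ∣ D F := by
  obtain ⟨k, rfl⟩ : ∃ k, m = k + 1 :=
    Nat.exists_eq_succ_of_ne_zero fun h0 => hm (by simp [h0])
  have h1 : F ^ (k + 1) ∣ Q * D (F ^ (k + 1) * M) := (dvd_mul_right _ _).trans h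
  rw [D.leibniz, D.leibniz_pow] at h1
  simp only [smul_eq_mul, nsmul_eq_mul, Nat.add_sub_cancel, mul_add] at h1
  rw [dvd_add_right (Dvd.intro _ (by ring : F ^ (k + 1) * (Q * D M) = _))] at h1
  have h2 : F ^ k * F ∣ F ^ k * (((k + 1 : ℕ) : MvPolynomial (Fin n) K) * (Q * M * D F)) := by
    convert h1 using 1 <;> ring
  have h3 := (mul_dvd_mul_iff_left (pow_ne_zero k hF.ne_zero)).1 h2
  rw [(isUnit_natCast hm).dvd_mul_left] at h3
  rcases hF.dvd_or_dvd h3 with h4 | h4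
  · rcases hF.dvd_or_dvd h4 with h5 | h5
    · exact absurd h5 hQ
    · exact absurd h5 hM
  · exact h4

lemma exists_prime_pow_pderiv_ne_zero {i : Fin n} (N : MvPolynomial (Fin n) K) :
    pderiv i N ≠ 0 → ∃ (F M : MvPolynomial (Fin n) K) (m : ℕ),
      Prime F ∧ N = F ^ m * M ∧ ¬ F ∣ M ∧ pderiv i (F ^ m) ≠ 0 := by
  have key : ∀ x y : MvPolynomial (Fin n) K, IsRelPrime x y →
      (∃ (F M : MvPolynomial (Fin n) K) (m : ℕ),
        Prime F ∧ x = F ^ m * M ∧ ¬ F ∣ M ∧ pderiv i (F ^ m) ≠ 0) →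
      ∃ (F M : MvPolynomial (Fin n) K) (m : ℕ),
        Prime F ∧ x * y = F ^ m * M ∧ ¬ F ∣ M ∧ pderiv i (F ^ m) ≠ 0 := by
    rintro x y hxy ⟨F, M, m, hF, rfl, hM, hm⟩
    refine ⟨F, M * y, m, hF, by ring, fun h => ?_, hm⟩
    rcases hF.dvd_or_dvd h with h | h
    · exact hM h
    · refine hF.not_isUnit (hxy (Dvd.dvd.mul_right (dvd_pow_self F ?_) _) h)
      rintro rfl
      simp at hm
  induction N using UniqueFactorizationMonoid.induction_on_coprime with
  | h0 => simp
  | h1 hx => exact fun h => absurd (pderiv_eq_zero_of_dvd hx.dvd) h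
  | hpr m hp => exact fun h => ⟨_, 1, m, hp, by simp, fun h1 => hp.not_isUnit (isUnit_of_dvd_one h1), h⟩
  | hcp hxy hx hy =>
    intro h
    rw [pderiv_mul] at h
    rename_i x y
    by_cases hx0 : pderiv i x = 0
    · rw [mul_comm]
      refine key _ _ hxy.symm (hy fun hy0 => h ?_)
      simp [hx0, hy0]
    · exact key _ _ hxy (hx hx0)

lemma exists_invariant_factor {J : Type*} (A : J → Fin n → MvPolynomial (Fin n) K)
    {N Q : MvPolynomial (Fin n) K} {i : Fin n} (hN : pderiv i N ≠ 0) (hNQ : IsRelPrime N Q)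
    (hd : ∀ j, N ∣ Q * polyField (A j) N) :
    ∃ F, Irreducible F ∧ F ∣ N ∧ pderiv i F ≠ 0 ∧ ∀ j, F ∣ polyField (A j) F := by
  obtain ⟨F, M, m, hF, rfl, hM, hm⟩ := exists_prime_pow_pderiv_ne_zero N hN
  obtain ⟨h1, h2⟩ := natCast_ne_zero_of_pderiv_pow_ne_zero hm
  have hm0 : m ≠ 0 := by
    rintro rfl
    simp at h1
  have hFN : F ∣ F ^ m * M := Dvd.dvd.mul_right (dvd_pow_self F hm0) _
  exact ⟨F, hF.irreducible, hFN, h2, fun j => dvd_derivation_of_dvd_mul _ hF hM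
    (fun h => hF.not_isUnit (hNQ hFN h)) h1 (hd j)⟩

lemma derivation_mul_pow_char (p : ℕ) [CharP K p] (D : Derivation K (Kz K n) (Kz K n))
    (f u : Kz K n) : D (f * u ^ p) = u ^ p * D f := by
  rw [D.leibniz, D.leibniz_pow]
  simp

lemma exists_invariant_of_finite [Finite K] {J : Type*}
    (A : J → Fin n → MvPolynomial (Fin n) K) {f : Kz K n} {i : Fin n} (hi : pdDer i f ≠ 0)
    (hf : ∀ j, ratField (A j) f = 0) (S : Finset (MvPolynomial (Fin n) K)) :
    ∃ F, Irreducible F ∧ pderiv i F ≠ 0 ∧ (∀ j, F ∣ polyField (A j) F) ∧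
      ∀ F' ∈ S, ¬ Associated F F' := by
  classical
  obtain ⟨p, hp⟩ := CharP.exists K
  have hp0 : p ≠ 0 := CharP.char_ne_zero_of_finite K p
  obtain ⟨P, Q, hQ, hPQ⟩ := exists_mul_toKz_eq f
  set H := ∏ G ∈ S.filter (· ≠ 0), G with hH
  have hH0 : H ≠ 0 := Finset.prod_ne_zero_iff.2 fun G hG => (Finset.mem_filter.1 hG).2
  set N := 1 + P * Q ^ (p - 1) * H ^ p with hN
  have hNf : toKz K n N = 1 + f * (toKz K n (Q * H)) ^ p := by
    rw [hN]
    simp only [map_add, map_one, map_mul, map_pow, ← hPQ]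
    rw [mul_pow, ← mul_pow_sub_one hp0 (toKz K n Q)]
    ring
  have hD : ∀ D : Derivation K (Kz K n) (Kz K n),
      D (toKz K n N) = (toKz K n (Q * H)) ^ p * D f := by
    intro D
    rw [hNf, map_add, D.map_one_eq_zero, zero_add, derivation_mul_pow_char]
  obtain ⟨F, hF, hFN, hFi, hFA⟩ := exists_invariant_factor A (N := N) (Q := 1) (i := i)
    (fun h => by
      have := hD (pdDer i)
      rw [pdDer_toKz, h, map_zero] at this
      exact mul_ne_zero (pow_ne_zero p (toKz_ne_zero (mul_ne_zero hQ hH0))) hi this.symm)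
    isRelPrime_one_right
    (fun j => by
      have := hD (ratField (A j))
      rw [ratField_toKz, hf, mul_zero, toKz_eq_zero_iff] at this
      rw [this, mul_zero]
      exact dvd_zero _)
  refine ⟨F, hF, hFi, hFA, fun F' hF' hass => hF.not_isUnit (isUnit_of_dvd_one ?_)⟩
  have h1 : F ∣ H := hass.dvd.trans
    (Finset.dvd_prod_of_mem _ (Finset.mem_filter.2 ⟨hF', fun h0 => hF.ne_zero (by
      rwa [h0, associated_zero_iff_eq_zero] at hass)⟩))
  rwa [hN, dvd_add_left ((h1.trans (dvd_pow_self H hp0)).mul_left _)] at hFN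

lemma exists_invariant_of_infinite [Infinite K] {J : Type*}
    (A : J → Fin n → MvPolynomial (Fin n) K) {f : Kz K n} {i : Fin n} (hi : pdDer i f ≠ 0)
    (hf : ∀ j, ratField (A j) f = 0) (S : Finset (MvPolynomial (Fin n) K)) :
    ∃ F, Irreducible F ∧ pderiv i F ≠ 0 ∧ (∀ j, F ∣ polyField (A j) F) ∧
      ∀ F' ∈ S, ¬ Associated F F' := by
  obtain ⟨P, ⟨Q, hQ⟩, hrel, rfl⟩ := IsFractionRing.exists_reduced_fraction
    (A := MvPolynomial (Fin n) K) f
  replace hrel : IsRelPrime P Q := hrel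
  set f : Kz K n := IsLocalization.mk' (Kz K n) P ⟨Q, hQ⟩ with hfdef
  have hQ0 : Q ≠ 0 := nonZeroDivisors.ne_zero hQ
  have hPQ : f * toKz K n Q = toKz K n P := IsLocalization.mk'_spec (Kz K n) P ⟨Q, hQ⟩
  have hrel' : ∀ c : K, IsRelPrime (P - C c * Q) Q := fun c d hd hdQ =>
    hrel ((dvd_sub_left (hdQ.mul_left _)).1 hd) hdQ
  have hX : ∀ j, Q * polyField (A j) P = P * polyField (A j) Q := by
    intro j
    have h1 := congrArg (ratField (A j)) hPQ
    rw [Derivation.leibniz, hf, smul_zero, add_zero, ratField_toKz, ratField_toKz,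
      smul_eq_mul] at h1
    apply toKz_injective
    rw [map_mul, map_mul, ← h1, ← hPQ]
    ring
  set good : Set K := {c | pderiv i (P - C c * Q) ≠ 0} with hgood
  have hinf : good.Infinite := by
    have hsub : goodᶜ.Subsingleton := by
      intro c hc c' hc'
      simp only [hgood, Set.mem_compl_iff, Set.mem_ofPred_eq, not_not, map_sub, pderiv_C_mul,
        sub_eq_zero] at hc hc'
      by_contra hne
      have h1 : C (c - c') * pderiv i Q = 0 := by
        rw [C_sub, sub_mul, ← hc, ← hc', sub_self]
      have h2 : pderiv i Q = 0 := by
        rcases mul_eq_zero.1 h1 with h | h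
        · exact absurd (sub_eq_zero.1 (C_eq_zero.1 h)) hne
        · exact h
      have h3 := congrArg (pdDer i) hPQ
      rw [Derivation.leibniz, pdDer_toKz, pdDer_toKz, hc, h2] at h3
      simp only [mul_zero, map_zero, zero_add, smul_eq_mul] at h3
      exact mul_ne_zero (toKz_ne_zero hQ0) hi h3
    simpa using hsub.finite.infinite_compl
  by_contra! hcon
  have hex : ∀ c ∈ good, ∃ G ∈ S, G ∣ P - C c * Q ∧ ¬ IsUnit G := by
    intro c hc
    obtain ⟨F, hF, hFN, hFi, hFA⟩ := exists_invariant_factor A (N := P - C c * Q) (Q := Q)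
      (i := i) hc (hrel' c) (fun j => by
        refine ⟨polyField (A j) Q, ?_⟩
        have hC : polyField (A j) (C c * Q) = C c * polyField (A j) Q := by
          rw [← smul_eq_C_mul, Derivation.map_smul, smul_eq_C_mul]
        rw [map_sub, hC]
        linear_combination hX j)
    obtain ⟨G, hG, hass⟩ := hcon F hF hFi hFA
    exact ⟨G, hG, hass.symm.dvd.trans hFN, fun hu => hF.not_isUnit (hass.symm.isUnit hu)⟩
  choose! g hgS hgd hgu using hex
  obtain ⟨c, hc, c', hc', hne, heq⟩ :=
    hinf.exists_ne_map_eq_of_mapsTo (f := g) (t := (S : Set _)) (fun c hc => hgS c hc) S.finite_toSet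
  have h1 : g c ∣ C (c' - c) * Q := by
    have := dvd_sub (hgd c hc) (heq ▸ hgd c' hc')
    convert this using 1
    rw [C_sub]
    ring
  rw [((IsUnit.mk0 (c' - c) (sub_ne_zero.2 hne.symm)).map (C (σ := Fin n))).dvd_mul_left] at h1
  exact hgu c hc (hrel' c (hgd c hc) h1)

end VectorFields

section LocalRing

variable {K n}

/-- The rational functions that are regular along the hypersurface `F = 0`. -/
def regularAt {F : MvPolynomial (Fin n) K} (hF : Prime F) : Subring (Kz K n) where
  carrier := {x | ∃ a b : MvPolynomial (Fin n) K, ¬ F ∣ b ∧ x * toKz K n b = toKz K n a}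
  zero_mem' := ⟨0, 1, fun h => hF.not_isUnit (isUnit_of_dvd_one h), by simp⟩
  one_mem' := ⟨1, 1, fun h => hF.not_isUnit (isUnit_of_dvd_one h), by simp⟩
  add_mem' := by
    rintro x y ⟨a, b, hb, h⟩ ⟨a', b', hb', h'⟩
    refine ⟨a * b' + a' * b, b * b', hF.not_dvd_mul hb hb', ?_⟩
    simp only [map_add, map_mul, ← h, ← h']
    ring
  mul_mem' := by
    rintro x y ⟨a, b, hb, h⟩ ⟨a', b', hb', h'⟩
    refine ⟨a * a', b * b', hF.not_dvd_mul hb hb', ?_⟩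
    simp only [map_mul, ← h, ← h']
    ring
  neg_mem' := by
    rintro x ⟨a, b, hb, h⟩
    exact ⟨-a, b, hb, by rw [map_neg, ← h, neg_mul]⟩

variable {F : MvPolynomial (Fin n) K} (hF : Prime F)

lemma toKz_mem_regularAt (a : MvPolynomial (Fin n) K) : toKz K n a ∈ regularAt hF :=
  ⟨a, 1, fun h => hF.not_isUnit (isUnit_of_dvd_one h), by simp⟩

lemma div_mem_regularAt (a : MvPolynomial (Fin n) K) {b : MvPolynomial (Fin n) K}
    (hb : ¬ F ∣ b) : toKz K n a / toKz K n b ∈ regularAt hF :=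
  ⟨a, b, hb, div_mul_cancel₀ _ (toKz_ne_zero fun h => hb (h ▸ dvd_zero F))⟩

lemma dvd_of_div_mem_regularAt {a : MvPolynomial (Fin n) K}
    (h : toKz K n a / toKz K n F ∈ regularAt hF) : F ∣ a := by
  obtain ⟨c, b, hb, h⟩ := h
  have h1 : a * b = F * c := by
    apply toKz_injective
    rw [map_mul, map_mul, ← h]
    field_simp [toKz_ne_zero hF.ne_zero]
  exact (hF.dvd_or_dvd ⟨c, h1⟩).resolve_right hb

lemma mem_regularAt_of_pdDer_eq_zero {i : Fin n} (hi : pderiv i F ≠ 0) {f : Kz K n}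
    (hf : pdDer i f = 0) (h : toKz K n F * f ∈ regularAt hF) : f ∈ regularAt hF := by
  obtain ⟨a, b, hb, h⟩ := h
  by_cases ha : F ∣ a
  · obtain ⟨a', rfl⟩ := ha
    refine ⟨a', b, hb, mul_left_cancel₀ (toKz_ne_zero hF.ne_zero) ?_⟩
    rw [← map_mul, ← h]
    ring
  · exfalso
    have h1 := congrArg (pdDer i) h
    rw [mul_comm (toKz K n F), mul_assoc, ← map_mul, Derivation.leibniz, hf, smul_zero, add_zero,
      pdDer_toKz, pdDer_toKz, smul_eq_mul] at h1
    have h2 : a * pderiv i (F * b) = F * b * pderiv i a := by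
      apply toKz_injective
      rw [map_mul, map_mul (toKz K n) (F * b), ← h1, ← h, map_mul (toKz K n) F b]
      ring
    rw [pderiv_mul] at h2
    have h3 : F ∣ a * b * pderiv i F :=
      ⟨b * pderiv i a - a * pderiv i b, by linear_combination h2⟩
    rcases hF.dvd_or_dvd h3 with h4 | h4
    · exact (hF.dvd_or_dvd h4).elim ha hb
    · exact hi (pderiv_eq_zero_of_dvd h4)

lemma exists_forall_mem_regularAt {ι : Type*} [Finite ι] (x : ι → Kz K n) :
    ∃ b : MvPolynomial (Fin n) K, b ≠ 0 ∧
      ∀ {F : MvPolynomial (Fin n) K} (hF : Prime F), ¬ F ∣ b → ∀ k, x k ∈ regularAt hF := by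
  obtain ⟨b, hb⟩ := IsLocalization.exist_integer_multiples_of_finite
    (nonZeroDivisors (MvPolynomial (Fin n) K)) x
  refine ⟨b, nonZeroDivisors.ne_zero b.2, fun hF hFb k => ?_⟩
  obtain ⟨a, ha⟩ := hb k
  refine ⟨a, b, hFb, ?_⟩
  change toKz K n a = _ at ha
  rw [ha, mul_comm, Algebra.smul_def]
  rfl

end LocalRing

section ClosedForms

variable {K n}

/-- The closed `1`-forms, in coordinates, annihilated by the vector fields `A`. -/
def closedAnnihilator {J : Type*} (A : J → Fin n → MvPolynomial (Fin n) K) :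
    Set (Fin n → Kz K n) :=
  {η | (∀ a b, pdDer a (η b) = pdDer b (η a)) ∧ ∀ j, ∑ a, toKz K n (A j a) * η a = 0}

lemma ratField_apply_of_mem {J : Type*} {A : J → Fin n → MvPolynomial (Fin n) K}
    {η : Fin n → Kz K n} (hη : η ∈ closedAnnihilator A) (j : J) (a : Fin n) :
    ratField (A j) (η a) = -∑ b, η b * toKz K n (pderiv a (A j b)) := by
  have h := congrArg (pdDer a) (hη.2 j)
  simp only [map_sum, Derivation.leibniz, map_zero, smul_eq_mul, Finset.sum_add_distrib,
    pdDer_toKz] at h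
  rw [ratField_apply, eq_neg_iff_add_eq_zero, ← h]
  congr 1
  exact Finset.sum_congr rfl fun b _ => by rw [hη.1 b a]

lemma ratField_coeff_eq_zero {J ι : Type*} [Fintype ι]
    {A : J → Fin n → MvPolynomial (Fin n) K} {B : ι → Fin n → Kz K n}
    (hB : ∀ k, B k ∈ closedAnnihilator A) (hli : LinearIndependent (Kz K n) B)
    {l : ι → Kz K n} (hl : ∑ k, l k • B k ∈ closedAnnihilator A) (j : J) (k : ι) :
    ratField (A j) (l k) = 0 := by
  refine Fintype.linearIndependent_iff.1 hli (fun k => ratField (A j) (l k)) ?_ k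
  ext a
  have h := ratField_apply_of_mem hl j a
  simp only [Finset.sum_apply, Pi.smul_apply, smul_eq_mul, map_sum, Derivation.leibniz,
    Finset.sum_add_distrib, fun k => ratField_apply_of_mem (hB k) j a, Pi.zero_apply] at h ⊢
  have h2 : ∑ k, l k * -∑ b, B k b * toKz K n (pderiv a (A j b)) =
      -∑ b, (∑ k, l k * B k b) * toKz K n (pderiv a (A j b)) := by
    simp only [mul_neg, Finset.sum_neg_distrib, Finset.mul_sum, Finset.sum_mul]
    rw [Finset.sum_comm]
    simp only [mul_assoc]
  rw [h2, add_eq_left] at h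
  rw [← h]
  exact Finset.sum_congr rfl fun k _ => mul_comm _ _

lemma log_combination_mem_closedAnnihilator {J ι : Type*}
    {A : J → Fin n → MvPolynomial (Fin n) K} {F : ι → MvPolynomial (Fin n) K}
    (hF : ∀ k, F k ≠ 0) {Θ : ι → J → MvPolynomial (Fin n) K}
    (hΘ : ∀ k j, polyField (A j) (F k) = F k * Θ k j) (s : Finset ι) (c : ι → K)
    (hc : ∀ j, ∑ k ∈ s, c k • Θ k j = 0) :
    (fun a => ∑ k ∈ s, c k • (toKz K n (pderiv a (F k)) / toKz K n (F k))) ∈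
      closedAnnihilator A := by
  constructor
  · intro a b
    simp only [map_sum, Derivation.map_smul, Derivation.leibniz_div, pdDer_toKz]
    refine Finset.sum_congr rfl fun k _ => ?_
    rw [pderiv_comm]
    simp only [smul_eq_mul]
    rw [mul_comm (toKz K n (pderiv b (F k))) (toKz K n (pderiv a (F k)))]
  · intro j
    have h := congrArg (toKz K n) (hc j)
    rw [map_zero, map_sum] at h
    rw [← h]
    simp only [Finset.mul_sum]
    rw [Finset.sum_comm]
    refine Finset.sum_congr rfl fun k _ => ?_
    have h1 := congrArg (toKz K n) (hΘ k j)
    rw [polyField_apply, map_sum, map_mul] at h1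
    have h2 : toKz K n (c k • Θ k j) = c k • toKz K n (Θ k j) := by
      rw [Algebra.smul_def, Algebra.smul_def, map_mul,
        IsScalarTower.algebraMap_apply K (MvPolynomial (Fin n) K) (Kz K n)]
      rfl
    rw [h2, ← mul_div_cancel_left₀ (toKz K n (Θ k j)) (toKz_ne_zero (hF k)), ← h1, Finset.sum_div,
      Finset.smul_sum]
    refine Finset.sum_congr rfl fun a _ => ?_
    rw [map_mul, mul_smul_comm, mul_div_assoc]

lemma totalDegree_cofactor_le {A : Fin n → MvPolynomial (Fin n) K} {D : ℕ}
    (hD : ∀ a, (A a).totalDegree ≤ D) {F Θ : MvPolynomial (Fin n) K} (hF : F ≠ 0)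
    (h : polyField A F = F * Θ) : Θ.totalDegree ≤ D := by
  by_cases hΘ : Θ = 0
  · simp [hΘ]
  have h1 : (polyField A F).totalDegree ≤ D + F.totalDegree := by
    rw [polyField_apply]
    refine totalDegree_finsetSum_le fun a _ => (totalDegree_mul _ _).trans ?_
    exact add_le_add (hD a) (totalDegree_pderiv_le a F)
  rw [h, totalDegree_mul_of_isDomain hF hΘ] at h1
  omega

/-- Infinitely many invariant hypersurfaces force a relation between their logarithmic
differentials modulo the annihilator of the vector fields. -/
lemma exists_cofactor_relation {J : Type*} [Finite J]
    {A : J → Fin n → MvPolynomial (Fin n) K} {F : ℕ → MvPolynomial (Fin n) K}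
    (hF : ∀ k, F k ≠ 0) {Θ : ℕ → J → MvPolynomial (Fin n) K}
    (hΘ : ∀ k j, polyField (A j) (F k) = F k * Θ k j) :
    ∃ (s : Finset ℕ) (c : ℕ → K), (∀ j, ∑ k ∈ s, c k • Θ k j = 0) ∧ ∃ k ∈ s, c k ≠ 0 := by
  obtain ⟨D, hD⟩ := (Set.finite_range fun x : J × Fin n => (A x.1 x.2).totalDegree).bddAbove
  have hD' : ∀ j a, (A j a).totalDegree ≤ D := fun j a => hD ⟨(j, a), rfl⟩
  let w : ℕ → J → restrictTotalDegree (Fin n) K D := fun k j => ⟨Θ k j,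
    (mem_restrictTotalDegree _ _ _).2 (totalDegree_cofactor_le (hD' j) (hF k) (hΘ k j))⟩
  have hw : ¬ LinearIndependent K w := fun h => by
    have := h.finite
    exact not_finite ℕ
  obtain ⟨s, c, hc, hne⟩ := not_linearIndependent_iff.1 hw
  refine ⟨s, c, fun j => ?_, hne⟩
  have := congrArg (fun v => ((v j : restrictTotalDegree (Fin n) K D) : MvPolynomial (Fin n) K)) hc
  simpa [w] using this

lemma exists_first_integral {J : Type*} [Finite J] (A : J → Fin n → MvPolynomial (Fin n) K)
    (hinf : ∀ S : Finset (MvPolynomial (Fin n) K), ∃ F, Irreducible F ∧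
      (∃ i, pderiv i F ≠ 0) ∧ (∀ j, F ∣ polyField (A j) F) ∧ ∀ F' ∈ S, ¬ Associated F F') :
    ∃ f : Kz K n, (∃ i, pdDer i f ≠ 0) ∧ ∀ j, ratField (A j) f = 0 := by
  classical
  by_contra! hno
  obtain ⟨B, hBV, hspan, hli⟩ := exists_linearIndependent (Kz K n) (closedAnnihilator A)
  have : Finite B := hli.finite
  have := Fintype.ofFinite B
  obtain ⟨g, hg⟩ := LinearMap.exists_leftInverse_of_injective
    (Fintype.linearCombination (Kz K n) ((↑) : B → Fin n → Kz K n))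
    (LinearMap.ker_eq_bot.2 hli.fintypeLinearCombination_injective)
  have hrep : ∀ η ∈ closedAnnihilator A, ∑ k, g η k • (k : Fin n → Kz K n) = η := by
    intro η hη
    have h1 : η ∈ Submodule.span (Kz K n) (Set.range ((↑) : B → Fin n → Kz K n)) := by
      rw [Subtype.range_coe, hspan]
      exact Submodule.subset_span hη
    rw [← Fintype.range_linearCombination] at h1
    obtain ⟨l, rfl⟩ := h1
    have h2 : g (Fintype.linearCombination (Kz K n) ((↑) : B → Fin n → Kz K n) l) = l :=
      LinearMap.congr_fun hg l
    rw [h2]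
    rfl
  obtain ⟨b, hb0, hb⟩ := exists_forall_mem_regularAt (fun x : (B × Fin n) ⊕ (B × Fin n) =>
    Sum.elim (fun y => y.1.1 y.2) (fun y => g (Pi.single y.2 1) y.1) x)
  obtain ⟨F, hF, hFne⟩ := exists_seq_of_forall_finset_exists
    (fun F : MvPolynomial (Fin n) K => Irreducible F ∧ (∃ i, pderiv i F ≠ 0) ∧
      (∀ j, F ∣ polyField (A j) F) ∧ ¬ F ∣ b) (fun F G => ¬ Associated G F) (by
    intro S _
    obtain ⟨F, h1, h2, h3, h4⟩ := hinf (S ∪ (UniqueFactorizationMonoid.factors b).toFinset)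
    refine ⟨F, ⟨h1, h2, h3, fun hFb => ?_⟩, fun F' hF' =>
      h4 F' (Finset.mem_union_left _ hF')⟩
    obtain ⟨q, hq, hass⟩ := UniqueFactorizationMonoid.exists_mem_factors_of_dvd hb0 h1 hFb
    exact h4 q (Finset.mem_union_right _ (Multiset.mem_toFinset.2 hq)) hass)
  have hndvd : ∀ k l, k ≠ l → ¬ F k ∣ F l := fun k l hkl hd => by
    have hass := (hF k).1.associated_of_dvd (hF l).1 hd
    rcases lt_or_gt_of_ne hkl with h | h
    · exact hFne k l h hass.symm
    · exact hFne l k h hass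
  choose Θ hΘ using fun k => (hF k).2.2.1
  obtain ⟨s, c, hc, k₀, hk₀, hck⟩ := exists_cofactor_relation (fun k => (hF k).1.ne_zero) hΘ
  have hη := log_combination_mem_closedAnnihilator (fun k => (hF k).1.ne_zero) hΘ s c hc
  set η : Fin n → Kz K n :=
    fun a => ∑ k ∈ s, c k • (toKz K n (pderiv a (F k)) / toKz K n (F k)) with hηdef
  have hP : Prime (F k₀) := (hF k₀).1.prime
  obtain ⟨i, hi⟩ := (hF k₀).2.1
  have hsmul : ∀ (r : K) {x : Kz K n}, x ∈ regularAt hP → r • x ∈ regularAt hP := by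
    intro r x hx
    rw [Algebra.smul_def, IsScalarTower.algebraMap_apply K (MvPolynomial (Fin n) K) (Kz K n)]
    exact mul_mem (toKz_mem_regularAt hP _) hx
  have hterm : ∀ a, ∀ k ∈ s.erase k₀,
      c k • (toKz K n (pderiv a (F k)) / toKz K n (F k)) ∈ regularAt hP := fun a k hk =>
    hsmul _ (div_mem_regularAt hP _ (hndvd k₀ k (Finset.ne_of_mem_erase hk).symm))
  have hsplit : ∀ a, η a = c k₀ • (toKz K n (pderiv a (F k₀)) / toKz K n (F k₀)) +
      ∑ k ∈ s.erase k₀, c k • (toKz K n (pderiv a (F k)) / toKz K n (F k)) := fun a =>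
    (Finset.add_sum_erase s _ hk₀).symm
  have hFη : ∀ a, toKz K n (F k₀) * η a ∈ regularAt hP := by
    intro a
    rw [hsplit, mul_add]
    refine add_mem ?_ (mul_mem (toKz_mem_regularAt hP _) (sum_mem (hterm a)))
    rw [mul_smul_comm, mul_div_cancel₀ _ (toKz_ne_zero hP.ne_zero)]
    exact hsmul _ (toKz_mem_regularAt hP _)
  have hgη : ∀ k, g η k ∈ regularAt hP := by
    intro k
    refine mem_regularAt_of_pdDer_eq_zero hP hi ?_ ?_
    · by_contra h0
      obtain ⟨j, hj⟩ := hno (g η k) ⟨i, h0⟩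
      exact hj (ratField_coeff_eq_zero (fun k : B => hBV k.2) hli
        (by rw [hrep η hη]; exact hη) j k)
    · have h1 : g η k = ∑ a, η a * g (Pi.single a 1) k := by
        conv_lhs => rw [pi_eq_sum_univ' η]
        simp [map_sum, Finset.sum_apply]
      rw [h1, Finset.mul_sum]
      refine sum_mem fun a _ => ?_
      rw [← mul_assoc]
      exact mul_mem (hFη a) (hb hP (hF k₀).2.2.2 (Sum.inr (k, a)))
  have hηi : η i ∈ regularAt hP := by
    rw [← hrep η hη, Finset.sum_apply]
    exact sum_mem fun k _ => mul_mem (hgη k) (hb hP (hF k₀).2.2.2 (Sum.inl (k, i)))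
  have hlast : c k₀ • (toKz K n (pderiv i (F k₀)) / toKz K n (F k₀)) ∈ regularAt hP := by
    have := sub_mem hηi (sum_mem (hterm i))
    rwa [hsplit, add_sub_cancel_right] at this
  have := hsmul (c k₀)⁻¹ hlast
  rw [inv_smul_smul₀ hck] at this
  exact hi (pderiv_eq_zero_of_dvd (dvd_of_div_mem_regularAt hP this))

end ClosedForms

section ExteriorCoordinates

variable {K n}

/-- The form `formOf K n r C`, as an element of the exterior power. -/
def extForm (r : ℕ) (C : (Fin r → Fin n) → Kz K n) : ⋀[Kz K n]^r (Fin n → Kz K n) :=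
  ∑ u, C u • exteriorPower.ιMulti (Kz K n) r fun i => Pi.single (u i) 1

lemma coe_ιMulti_single (r : ℕ) (u : Fin r → Fin n) :
    ((exteriorPower.ιMulti (Kz K n) r fun i => (Pi.single (u i) 1 : Fin n → Kz K n) :
      ⋀[Kz K n]^r (Fin n → Kz K n)) : Forms K n) =
      dzP K n r u := by
  rw [exteriorPower.ιMulti_apply_coe, ExteriorAlgebra.ιMulti_apply]
  rfl

lemma coe_extForm (r : ℕ) (C : (Fin r → Fin n) → Kz K n) :
    (extForm r C : Forms K n) = formOf K n r C := by
  rw [extForm, formOf]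
  simp only [Submodule.coe_sum, Submodule.coe_smul, coe_ιMulti_single]

/-- The coordinate of `dz_u` along the basis element indexed by `s`. -/
def minorCoeff (r : ℕ) (s : Set.powersetCard (Fin n) r) (u : Fin r → Fin n) :
    MvPolynomial (Fin n) K :=
  (Matrix.of fun i j =>
    (Pi.single (u i) 1 : Fin n → MvPolynomial (Fin n) K)
      (Set.powersetCard.ofFinEmbEquiv.symm s j)).det

lemma repr_extForm (r : ℕ) (C : (Fin r → Fin n) → Kz K n) (s : Set.powersetCard (Fin n) r) :
    ((Pi.basisFun (Kz K n) (Fin n)).exteriorPower r).repr (extForm r C) s =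
      ∑ u, C u * toKz K n (minorCoeff r s u) := by
  rw [exteriorPower.basis_repr_apply, extForm, map_sum]
  refine Finset.sum_congr rfl fun u _ => ?_
  rw [map_smul, exteriorPower.ιMultiDual_apply_ιMulti, smul_eq_mul, minorCoeff, RingHom.map_det]
  congr 2
  ext i j
  simp [Pi.single_apply, apply_ite (toKz K n)]

lemma coe_basis_exteriorPower (r : ℕ) (s : Set.powersetCard (Fin n) r) :
    (((Pi.basisFun (Kz K n) (Fin n)).exteriorPower r s : ⋀[Kz K n]^r (Fin n → Kz K n)) :
      Forms K n) = dzP K n r (Set.powersetCard.ofFinEmbEquiv.symm s) := by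
  rw [exteriorPower.basis_apply, exteriorPower.ιMulti_family, ← coe_ιMulti_single]
  congr 2
  ext i j
  simp [Pi.basisFun_apply]

lemma dd_eq_oneForm (f : Kz K n) : dd K n f = oneForm K n fun i => pdDer i f := by
  rw [dd, oneForm, pi_eq_sum_univ' (fun i => pdDer i f), map_sum]
  refine Finset.sum_congr rfl fun i _ => ?_
  rw [map_smul, pdDer_apply, dz]

lemma dd_ne_zero_iff (f : Kz K n) : dd K n f ≠ 0 ↔ ∃ i, pdDer i f ≠ 0 := by
  rw [dd_eq_oneForm, oneForm, Ne, ExteriorAlgebra.ι_eq_zero_iff, funext_iff, not_forall]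
  rfl

lemma formOf_mul_dd (r : ℕ) (C : (Fin r → Fin n) → Kz K n) (f : Kz K n) :
    formOf K n r C * dd K n f =
      formOf K n (r + 1) fun u => C (Fin.init u) * pdDer (u (Fin.last r)) f := by
  have hsnoc : ∀ (a : Fin n) (s : Fin r → Fin n),
      dzP K n (r + 1) (Fin.snoc (α := fun _ => Fin n) s a) = dzP K n r s * dz K n a := by
    intro a s
    rw [dzP, dzP, List.ofFn_succ_last]
    simp
  rw [formOf, dd, formOf, Finset.sum_mul_sum, Finset.sum_comm, ← Fintype.sum_prod_type',
    ← (Fin.snocEquiv fun _ : Fin (r + 1) => Fin n).sum_comp]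
  refine Finset.sum_congr rfl fun ⟨a, s⟩ _ => ?_
  change C s • dzP K n r s * pd K n a f • dz K n a =
    (C (Fin.init (Fin.snoc (α := fun _ => Fin n) s a)) *
      pdDer (Fin.snoc (α := fun _ => Fin n) s a (Fin.last r)) f) •
        dzP K n (r + 1) (Fin.snoc (α := fun _ => Fin n) s a)
  rw [hsnoc, Fin.init_snoc, Fin.snoc_last, pdDer_apply, smul_mul_smul_comm]

/-- The polynomial vector fields whose values are the coordinates of `ω ∧ df`. -/
def wedgeField (r : ℕ) (c : (Fin r → Fin n) → MvPolynomial (Fin n) K)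
    (s : Set.powersetCard (Fin n) (r + 1)) (a : Fin n) : MvPolynomial (Fin n) K :=
  ∑ u : Fin (r + 1) → Fin n,
    if u (Fin.last r) = a then c (Fin.init u) * minorCoeff (r + 1) s u else 0

lemma ratField_wedgeField (r : ℕ) (c : (Fin r → Fin n) → MvPolynomial (Fin n) K)
    (s : Set.powersetCard (Fin n) (r + 1)) (f : Kz K n) :
    ratField (wedgeField r c s) f =
      ((Pi.basisFun (Kz K n) (Fin n)).exteriorPower (r + 1)).repr
        (extForm (r + 1) fun u => toKz K n (c (Fin.init u)) * pdDer (u (Fin.last r)) f) s := by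
  rw [repr_extForm, ratField_apply]
  simp only [wedgeField, map_sum, Finset.sum_mul, apply_ite (toKz K n), map_zero, ite_mul, zero_mul]
  rw [Finset.sum_comm]
  refine Finset.sum_congr rfl fun u _ => ?_
  rw [Finset.sum_ite_eq, if_pos (Finset.mem_univ _), map_mul]
  ring

lemma polyFormOf_mul_dd (r : ℕ) (c : (Fin r → Fin n) → MvPolynomial (Fin n) K) (f : Kz K n) :
    polyFormOf K n r c * dd K n f =
      ∑ s, ratField (wedgeField r c s) f •
        dzP K n (r + 1) (Set.powersetCard.ofFinEmbEquiv.symm s) := by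
  simp only [ratField_wedgeField, ← coe_basis_exteriorPower]
  rw [polyFormOf, formOf_mul_dd, ← coe_extForm]
  conv_lhs => rw [← ((Pi.basisFun (Kz K n) (Fin n)).exteriorPower (r + 1)).sum_repr (extForm _ _)]
  simp only [Submodule.coe_sum, Submodule.coe_smul]

lemma isFirstIntegral_iff (r : ℕ) (c : (Fin r → Fin n) → MvPolynomial (Fin n) K) (f : Kz K n) :
    IsFirstIntegral K n (polyFormOf K n r c) f ↔
      (∃ i, pdDer i f ≠ 0) ∧ ∀ s, ratField (wedgeField r c s) f = 0 := by
  rw [IsFirstIntegral, dd_ne_zero_iff]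
  refine and_congr_right fun _ => ⟨fun h s => ?_, fun h => ?_⟩
  · rw [polyFormOf, formOf_mul_dd, ← coe_extForm, ZeroMemClass.coe_eq_zero] at h
    rw [ratField_wedgeField, h, map_zero, Finsupp.zero_apply]
  · rw [polyFormOf_mul_dd]
    simp [h]

lemma formInvariant_iff (r : ℕ) (c : (Fin r → Fin n) → MvPolynomial (Fin n) K)
    (F : MvPolynomial (Fin n) K) :
    FormInvariant K n r (polyFormOf K n r c) F ↔
      (∃ i, pderiv i F ≠ 0) ∧ ∀ s, F ∣ polyField (wedgeField r c s) F := by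
  rw [FormInvariant, dd_ne_zero_iff]
  refine and_congr (exists_congr fun i => ?_) ⟨?_, fun h => ?_⟩
  · rw [pdDer_toKz, Ne, toKz_eq_zero_iff]
  · rintro ⟨Θ, hΘ⟩ s
    rw [polyFormOf, polyFormOf, formOf_mul_dd, ← coe_extForm, ← coe_extForm, ← Submodule.coe_smul,
      SetLike.coe_eq_coe] at hΘ
    refine ⟨∑ u, Θ u * minorCoeff (r + 1) s u, toKz_injective ?_⟩
    rw [← ratField_toKz, ratField_wedgeField, hΘ, map_smul, Finsupp.smul_apply, repr_extForm]
    simp only [smul_eq_mul, map_mul, map_sum]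
  · classical
    choose q hq using h
    refine ⟨fun t => ∑ s, if (Set.powersetCard.ofFinEmbEquiv.symm s : Fin (r + 1) → Fin n) = t
      then q s else 0, ?_⟩
    rw [polyFormOf_mul_dd, polyFormOf, formOf, Finset.smul_sum]
    simp only [map_sum, Finset.sum_smul, Finset.smul_sum]
    rw [Finset.sum_comm]
    refine Finset.sum_congr rfl fun s _ => ?_
    simp only [apply_ite (toKz K n), map_zero, ite_smul, zero_smul, smul_ite, smul_zero]
    rw [Finset.sum_ite_eq, if_pos (Finset.mem_univ _), ratField_toKz, hq s, map_mul, smul_smul]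

end ExteriorCoordinates

/-- A polynomial `r`-form `ω` on `Kⁿ`, `1 ≤ r < n`, has a rational first integral if and
only if it has infinitely many pairwise non-associate invariant irreducible polynomials
(i.e. outside any finite set, up to associates, there is another one). -/
theorem statement15 (r : ℕ) (hr : 1 ≤ r) (hrn : r < n)
    (c : (Fin r → Fin n) → MvPolynomial (Fin n) K) :
    (∃ f : Kz K n, IsFirstIntegral K n (polyFormOf K n r c) f) ↔
      (∀ S : Finset (MvPolynomial (Fin n) K), ∃ F : MvPolynomial (Fin n) K,
        Irreducible F ∧ FormInvariant K n r (polyFormOf K n r c) F ∧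
          ∀ F' ∈ S, ¬ Associated F F') := by
  simp only [isFirstIntegral_iff, formInvariant_iff]
  constructor
  · rintro ⟨f, ⟨i, hi⟩, hf⟩ S
    obtain ⟨F, hF, hFi, hFA, hFS⟩ : ∃ F, Irreducible F ∧ pderiv i F ≠ 0 ∧
        (∀ s, F ∣ polyField (wedgeField r c s) F) ∧ ∀ F' ∈ S, ¬ Associated F F' := by
      rcases finite_or_infinite K with _ | _
      · exact exists_invariant_of_finite _ hi hf S
      · exact exists_invariant_of_infinite _ hi hf S
    exact ⟨F, hF, ⟨⟨i, hFi⟩, hFA⟩, hFS⟩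
  · intro h
    refine exists_first_integral _ fun S => ?_
    obtain ⟨F, hF, ⟨hi, hFA⟩, hFS⟩ := h S
    exact ⟨F, hF, hi, hFA, hFS⟩
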